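/- Let F : [0,1]ⁿ → ℝ be continuous submodular with F(0⃗) + F(1⃗) ≥ 0, let x* ∈ [0,1]ⁿ, and let ẑ ∈ [0,1]ⁿ. Define X^{(i)}, Y^{(i)}, O^{(i)} as the vectors agreeing with ẑ on the first i coordinates and with 0⃗, 1⃗, x* respectively on the rest. Suppose for each i: F(X^{(i)}) - F(X^{(i-1)}) ≥ a_i, F(Y^{(i)}) - F(Y^{(i-1)}) ≥ b_i, F(O^{(i-1)}) - F(O^{(i)}) ≤ c_i, and (1/2)a_i + (1/2)b_i - c_i ≥ -δ/n for δ > 0. Then 2·F(ẑ) ≥ F(x*) - δ. -/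

import Mathlib

theorem stmt_18 (n : ℕ) (F : (Fin n → ℝ) → ℝ)
    (hsub : ∀ x y : Fin n → ℝ, x ∈ Set.Icc (0:Fin n → ℝ) 1 → y ∈ Set.Icc (0:Fin n → ℝ) 1 →
      F x + F y ≥ F (x ⊔ y) + F (x ⊓ y))
    (h01 : F (0 : Fin n → ℝ) + F (1 : Fin n → ℝ) ≥ 0)
    (zhat xstar : Fin n → ℝ)
    (hz : zhat ∈ Set.Icc (0:Fin n → ℝ) 1) (hx : xstar ∈ Set.Icc (0:Fin n → ℝ) 1)
    (X Y O : ℕ → (Fin n → ℝ))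
    (hX : ∀ k, X k = fun (j : Fin n) => if (j:ℕ) < k then zhat j else 0)
    (hY : ∀ k, Y k = fun (j : Fin n) => if (j:ℕ) < k then zhat j else 1)
    (hO : ∀ k, O k = fun (j : Fin n) => if (j:ℕ) < k then zhat j else xstar j)
    (a b c : Fin n → ℝ) (δ : ℝ) (hδ : 0 < δ)
    (ha : ∀ i : Fin n, F (X ((i:ℕ) + 1)) - F (X (i:ℕ)) ≥ a i)
    (hb : ∀ i : Fin n, F (Y ((i:ℕ) + 1)) - F (Y (i:ℕ)) ≥ b i)
    (hc : ∀ i : Fin n, F (O (i:ℕ)) - F (O ((i:ℕ) + 1)) ≤ c i)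
    (hgame : ∀ i : Fin n, (1/2) * a i + (1/2) * b i - c i ≥ -δ / n) :
    2 * F zhat ≥ F xstar - δ := by
  have key : ∀ k : ℕ, k ≤ n →
      (1/2) * (F (X k) + F (Y k)) + F (O k)
        ≥ (1/2) * (F (X 0) + F (Y 0)) + F (O 0) + k * (-δ / n) := by
    intro k
    induction k with
    | zero => intro _; simp
    | succ k ih =>
      intro hk
      have h0 := ih (by omega)
      have h1 := ha ⟨k, by omega⟩
      have h2 := hb ⟨k, by omega⟩
      have h3 := hc ⟨k, by omega⟩
      have h4 := hgame ⟨k, by omega⟩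
      simp only at h1 h2 h3
      push_cast
      linarith
  have h := key n le_rfl
  have hX0 : X 0 = 0 := by rw [hX]; ext j; simp
  have hY0 : Y 0 = 1 := by rw [hY]; ext j; simp
  have hO0 : O 0 = xstar := by rw [hO]; ext j; simp
  have hXn : X n = zhat := by rw [hX]; ext j; simp
  have hYn : Y n = zhat := by rw [hY]; ext j; simp
  have hOn : O n = zhat := by rw [hO]; ext j; simp
  rw [hX0, hY0, hO0, hXn, hYn, hOn] at h
  have hd : (n : ℝ) * (-δ / n) ≥ -δ := by
    rcases Nat.eq_zero_or_pos n with h0 | h0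
    · have : (n : ℝ) = 0 := by exact_mod_cast h0
      rw [this]; simp; exact hδ.le
    · have : (n : ℝ) ≠ 0 := by positivity
      rw [mul_div_cancel₀ _ this]
  linarith
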